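/- Let t be a nonnegative integer and n an integer with n ≥ 2t. If F(n,t) := ((n−t)!)² · t! / (n! · (n−2t)!) > 1, then no nontrivial perfect t-error correcting permutation code exists in S_n. -/

import Mathlib

/-- Length of a longest common subsequence of two lists. -/
noncomputable def lcsLen {α : Type*} (x y : List α) : ℕ :=
  sSup {k | ∃ z : List α, z.length = k ∧ z.Sublist x ∧ z.Sublist y}
/-- The sequence `(σ(1), …, σ(n))` associated with a permutation `σ ∈ S_n`
(positions are 0-indexed here, values 1-indexed). -/
def permSeq {n : ℕ} (σ : Equiv.Perm (Fin n)) : List ℕ :=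
  List.ofFn fun i => (σ i : ℕ) + 1

/-- The Ulam distance `d∘(σ,π) = n - ℓ(σ,π)` between permutations. -/
noncomputable def pdist {n : ℕ} (σ π : Equiv.Perm (Fin n)) : ℕ :=
  n - lcsLen (permSeq σ) (permSeq π)

/-- The permutation Ulam sphere of radius `t` centered at `σ`. -/
noncomputable def psphere {n : ℕ} (σ : Equiv.Perm (Fin n)) (t : ℕ) :
    Set (Equiv.Perm (Fin n)) :=
  {π | pdist σ π ≤ t}
/-- A perfect `t`-error correcting permutation code in the Ulam metric:
every permutation lies in the radius-`t` Ulam sphere of a unique codeword. -/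
noncomputable def IsPerfectPermCode {n : ℕ} (t : ℕ) (C : Set (Equiv.Perm (Fin n))) : Prop :=
  ∀ σ : Equiv.Perm (Fin n), ∃! c, c ∈ C ∧ σ ∈ psphere c t
/-- `F(n,t) = ((n-t)!)² · t! / (n! · (n-2t)!)`, as a real number. -/
noncomputable def Ffun (n t : ℕ) : ℝ :=
  ((n - t).factorial : ℝ) ^ 2 * (t.factorial : ℝ) /
    ((n.factorial : ℝ) * ((n - 2 * t).factorial : ℝ))

/-- Two lists with a common sublist `w` can be amalgamated over `w`. -/
theorem List.Sublist.exists_amalgam {α : Type*} {w u : List α} (hu : w.Sublist u) :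
    ∀ {v : List α}, w.Sublist v →
      ∃ z : List α, u.Sublist z ∧ v.Sublist z ∧ (z ++ w).Perm (u ++ v) := by
  induction hu with
  | slnil =>
    intro v _
    exact ⟨v, List.nil_sublist v, List.Sublist.refl v, by simp⟩
  | cons a _ ih =>
    intro v hv
    obtain ⟨z, h1, h2, h3⟩ := ih hv
    exact ⟨a :: z, h1.cons_cons a, h2.cons a, by simpa using h3⟩
  | @cons_cons w u a _ ih =>
    intro v hv
    obtain ⟨r₁, r₂, rfl, ha, hw⟩ := List.cons_sublist_iff.1 hv
    obtain ⟨p, q, rfl⟩ := List.append_of_mem ha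
    obtain ⟨z, h1, h2, h3⟩ := ih (hw.trans (List.sublist_append_right q r₂))
    refine ⟨p ++ a :: z, (h1.cons_cons a).trans (List.sublist_append_right _ _), ?_, ?_⟩
    · simpa using (List.Sublist.refl p).append (h2.cons_cons a)
    · classical
      rw [List.perm_iff_count] at h3 ⊢
      intro b
      have := h3 b
      simp only [List.count_append, List.count_cons, List.append_assoc, List.cons_append] at this ⊢
      omega

/-- A sublist of a duplicate-free list is recovered by filtering. -/
theorem List.Sublist.filter_mem_eq {α : Type*} [DecidableEq α] {u l : List α}
    (h : u.Sublist l) (hl : l.Nodup) : l.filter (· ∈ u) = u := by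
  have h1 : u.Sublist (l.filter (· ∈ u)) := by
    have := h.filter (· ∈ u)
    rwa [List.filter_eq_self.2 (by simp)] at this
  refine (h1.eq_of_length_le ?_).symm
  exact ((hl.filter _).subperm (fun x hx => by simpa using (List.mem_filter.1 hx).2)).length_le

section Words

variable {n : ℕ}

theorem nodup_ofFn_perm (σ : Equiv.Perm (Fin n)) : (List.ofFn σ).Nodup :=
  List.nodup_ofFn.2 σ.injective

theorem mem_ofFn_perm (σ : Equiv.Perm (Fin n)) (x : Fin n) : x ∈ List.ofFn σ :=
  List.mem_ofFn.2 (σ.surjective x)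

theorem length_filter_ofFn_perm (σ : Equiv.Perm (Fin n)) (A : Finset (Fin n)) :
    ((List.ofFn σ).filter (· ∈ A)).length = A.card := by
  rw [← List.toFinset_card_of_nodup ((nodup_ofFn_perm σ).filter _)]
  congr 1
  ext x
  simp [σ.surjective x]

theorem exists_perm_ofFn_eq {z : List (Fin n)} (hz : z.Nodup) (hl : z.length = n) :
    ∃ π : Equiv.Perm (Fin n), List.ofFn π = z := by
  have hinj : Function.Injective fun i : Fin n => z.get (i.cast hl.symm) :=
    (List.nodup_iff_injective_get.1 hz).comp (Fin.cast_injective _)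
  refine ⟨Equiv.ofBijective _ (Finite.injective_iff_bijective.1 hinj), ?_⟩
  apply List.ext_get <;> simp [hl]

theorem permSeq_eq_map (σ : Equiv.Perm (Fin n)) :
    permSeq σ = (List.ofFn σ).map fun i : Fin n => (i : ℕ) + 1 := by
  simp [permSeq, List.map_ofFn, Function.comp_def]

theorem mem_psphere_iff (σ π : Equiv.Perm (Fin n)) (t : ℕ) :
    π ∈ psphere σ t ↔ ∃ u : List (Fin n),
      u.Sublist (List.ofFn σ) ∧ u.Sublist (List.ofFn π) ∧ n - t ≤ u.length := by
  have hinj : Function.Injective fun i : Fin n => (i : ℕ) + 1 := fun i j h => by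
    apply Fin.ext; simpa using h
  have hbdd : BddAbove {k | ∃ z : List ℕ, z.length = k ∧
      z.Sublist (permSeq σ) ∧ z.Sublist (permSeq π)} :=
    ⟨n, by rintro k ⟨z, rfl, h, -⟩; simpa [permSeq] using h.length_le⟩
  have hne : {k | ∃ z : List ℕ, z.length = k ∧
      z.Sublist (permSeq σ) ∧ z.Sublist (permSeq π)}.Nonempty := ⟨0, [], by simp⟩
  simp only [psphere, Set.mem_ofPred_eq, pdist]
  constructor
  · intro h
    obtain ⟨z, hz, h1, h2⟩ := Nat.sSup_mem hne hbdd
    change _ = lcsLen _ _ at hz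
    rw [permSeq_eq_map, List.sublist_map_iff] at h1 h2
    obtain ⟨u, hu, rfl⟩ := h1
    obtain ⟨v, hv, huv⟩ := h2
    obtain rfl := List.map_injective_iff.2 hinj huv
    refine ⟨u, hu, hv, ?_⟩
    simp only [List.length_map] at hz
    omega
  · rintro ⟨u, h1, h2, h3⟩
    have : u.length ≤ lcsLen (permSeq σ) (permSeq π) :=
      le_csSup hbdd ⟨u.map fun i : Fin n => (i : ℕ) + 1, by simp,
        by rw [permSeq_eq_map]; exact h1.map _, by rw [permSeq_eq_map]; exact h2.map _⟩
    omega

theorem exists_filter_eq_of_mem_psphere {σ π : Equiv.Perm (Fin n)} {t : ℕ}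
    (h : π ∈ psphere σ t) : ∃ T : Finset (Fin n), T.card = n - t ∧
      (List.ofFn π).filter (· ∈ T) = (List.ofFn σ).filter (· ∈ T) := by
  obtain ⟨u, h1, h2, h3⟩ := (mem_psphere_iff σ π t).1 h
  have h1' := (u.take_sublist (n - t)).trans h1
  have h2' := (u.take_sublist (n - t)).trans h2
  refine ⟨(u.take (n - t)).toFinset, ?_, ?_⟩
  · rw [List.toFinset_card_of_nodup (h1'.nodup (nodup_ofFn_perm σ))]
    simpa using h3
  · simp only [List.mem_toFinset]
    rw [h1'.filter_mem_eq (nodup_ofFn_perm σ), h2'.filter_mem_eq (nodup_ofFn_perm π)]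

/-- At most `n! / |T|!` permutations have a prescribed relative order of the symbols in `T`. -/
theorem card_filter_order_eq_mul_le (T : Finset (Fin n)) (w : List (Fin n)) :
    {π : Equiv.Perm (Fin n) | (List.ofFn π).filter (· ∈ T) = w}.ncard * T.card.factorial
      ≤ n.factorial := by
  classical
  have key : ∀ (g : Equiv.Perm T) (π : Equiv.Perm (Fin n)),
      (List.ofFn (Equiv.Perm.ofSubtype g * π)).filter (· ∈ T) =
        ((List.ofFn π).filter (· ∈ T)).map (Equiv.Perm.ofSubtype g) := by
    intro g π
    have : List.ofFn (Equiv.Perm.ofSubtype g * π) =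
        (List.ofFn π).map (Equiv.Perm.ofSubtype g) := by
      simp [List.map_ofFn, Function.comp_def]
    rw [this, List.filter_map]
    congr 1
    apply List.filter_congr
    intro x _
    simp only [Function.comp_apply, decide_eq_decide]
    exact Equiv.Perm.ofSubtype_apply_mem_iff_mem g x
  set P := {π : Equiv.Perm (Fin n) | (List.ofFn π).filter (· ∈ T) = w} with hP
  have hinj : Function.Injective fun p : P × Equiv.Perm T =>
      Equiv.Perm.ofSubtype p.2 * (p.1 : Equiv.Perm (Fin n)) := by
    rintro ⟨⟨π, hπ⟩, g⟩ ⟨⟨ρ, hρ⟩, k⟩ h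
    simp only at h
    have e := key g π
    rw [h, key k ρ, hπ.out, hρ.out, List.map_inj_left] at e
    have hgk : g = k := by
      ext x
      have hx : (x : Fin n) ∈ w := by
        rw [← hπ.out]; simp [π.surjective (x : Fin n)]
      have := e x hx
      simpa using congrArg Fin.val this.symm
    subst hgk
    simpa using h
  have := Nat.card_le_card_of_injective _ hinj
  rwa [Nat.card_prod, Nat.card_perm, Nat.card_perm, Nat.card_coe_set_eq, Nat.card_eq_fintype_card,
    Fintype.card_coe, Nat.card_fin] at this

theorem ncard_psphere_mul_le (σ : Equiv.Perm (Fin n)) (t : ℕ) :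
    (psphere σ t).ncard * (n - t).factorial ≤ n.choose (n - t) * n.factorial := by
  classical
  have hsub : psphere σ t ⊆ ⋃ T ∈ Finset.powersetCard (n - t) (Finset.univ : Finset (Fin n)),
      {π : Equiv.Perm (Fin n) |
        (List.ofFn π).filter (· ∈ T) = (List.ofFn σ).filter (· ∈ T)} := by
    intro π hπ
    obtain ⟨T, hT, h⟩ := exists_filter_eq_of_mem_psphere hπ
    simp only [Set.mem_iUnion]
    exact ⟨T, by simp [Finset.mem_powersetCard, hT], h⟩
  calc (psphere σ t).ncard * (n - t).factorial
      ≤ (∑ T ∈ Finset.powersetCard (n - t) (Finset.univ : Finset (Fin n)),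
          {π : Equiv.Perm (Fin n) |
            (List.ofFn π).filter (· ∈ T) = (List.ofFn σ).filter (· ∈ T)}.ncard)
            * (n - t).factorial := by
        gcongr
        exact (Set.ncard_le_ncard hsub (Set.toFinite _)).trans
          (Finset.set_ncard_biUnion_le _ _)
    _ ≤ ∑ T ∈ Finset.powersetCard (n - t) (Finset.univ : Finset (Fin n)), n.factorial := by
        rw [Finset.sum_mul]
        refine Finset.sum_le_sum fun T hT => ?_
        rw [← (Finset.mem_powersetCard.1 hT).2]
        exact card_filter_order_eq_mul_le T _
    _ = n.choose (n - t) * n.factorial := by simp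

/-- Spheres around permutations inducing the same order on `n - 2t` symbols intersect. -/
theorem exists_mem_psphere_of_filter_eq {t : ℕ} (hn : 2 * t ≤ n) {A : Finset (Fin n)}
    (hA : A.card = n - 2 * t) {c d : Equiv.Perm (Fin n)}
    (h : (List.ofFn c).filter (· ∈ A) = (List.ofFn d).filter (· ∈ A)) :
    ∃ π, π ∈ psphere c t ∧ π ∈ psphere d t := by
  classical
  obtain ⟨B, hAB, -, hB⟩ := Finset.exists_subsuperset_card_eq (n := n - t)
    (Finset.subset_univ A) (by omega) (by simp)
  have hB' : (A ∪ Bᶜ).card = n - t := by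
    rw [Finset.card_union_of_disjoint, Finset.card_compl, hA, hB, Fintype.card_fin]
    · omega
    · exact Finset.disjoint_left.2 fun x hx hx' => (Finset.mem_compl.1 hx') (hAB hx)
  have hu : ((List.ofFn c).filter (· ∈ A)).Sublist ((List.ofFn c).filter (· ∈ B)) :=
    List.monotone_filter_right _ fun x hx => by simpa using hAB (by simpa using hx)
  have hv : ((List.ofFn c).filter (· ∈ A)).Sublist ((List.ofFn d).filter (· ∈ A ∪ Bᶜ)) := by
    rw [h]
    exact List.monotone_filter_right _ fun x hx => by
      have : x ∈ A := by simpa using hx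
      simp [this]
  obtain ⟨z, h1, h2, h3⟩ := hu.exists_amalgam hv
  have hlen : z.length = n := by
    have := h3.length_eq
    simp only [List.length_append, length_filter_ofFn_perm, hA, hB, hB'] at this
    omega
  have hnodup : z.Nodup := by
    refine List.nodup_iff_count_le_one.2 fun x => ?_
    have e := List.perm_iff_count.1 h3 x
    have count_filter : ∀ (σ : Equiv.Perm (Fin n)) (S : Finset (Fin n)),
        ((List.ofFn σ).filter (· ∈ S)).count x = if x ∈ S then 1 else 0 := by
      intro σ S
      split_ifs with hx
      · exact List.count_eq_one_of_mem ((nodup_ofFn_perm σ).filter _)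
          (List.mem_filter.2 ⟨mem_ofFn_perm σ x, by simpa using hx⟩)
      · exact List.count_eq_zero_of_not_mem fun hm => hx (by simpa using (List.mem_filter.1 hm).2)
    rw [List.count_append, List.count_append, count_filter, count_filter, count_filter] at e
    simp only [Finset.mem_union, Finset.mem_compl] at e
    have := @hAB x
    split_ifs at e <;> first | omega | tauto
  obtain ⟨π, rfl⟩ := exists_perm_ofFn_eq hnodup hlen
  refine ⟨π, (mem_psphere_iff _ _ _).2 ⟨_, List.filter_sublist, h1, ?_⟩,
    (mem_psphere_iff _ _ _).2 ⟨_, List.filter_sublist, h2, ?_⟩⟩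
  · rw [length_filter_ofFn_perm, hB]
  · rw [length_filter_ofFn_perm, hB']

/-- A Singleton-type bound for perfect codes. -/
theorem IsPerfectPermCode.ncard_le {t : ℕ} (hn : 2 * t ≤ n) {C : Set (Equiv.Perm (Fin n))}
    (hC : IsPerfectPermCode t C) : C.ncard ≤ (n - 2 * t).factorial := by
  classical
  obtain ⟨A, -, hA⟩ := Finset.exists_subset_card_eq
    (s := (Finset.univ : Finset (Fin n))) (n := n - 2 * t) (by simp)
  have hmaps : ∀ c ∈ C, (List.ofFn c).filter (· ∈ A) ∈
      (A.toList.permutations.toFinset : Set (List (Fin n))) := by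
    intro c _
    simp only [List.coe_toFinset, List.mem_permutations, Set.mem_ofPred_eq]
    rw [List.perm_ext_iff_of_nodup ((nodup_ofFn_perm c).filter _) A.nodup_toList]
    intro x
    simp [c.surjective x]
  have hinj : Set.InjOn (fun c : Equiv.Perm (Fin n) => (List.ofFn c).filter (· ∈ A)) C := by
    intro c hc d hd h
    obtain ⟨π, h1, h2⟩ := exists_mem_psphere_of_filter_eq hn hA h
    exact (hC π).unique ⟨hc, h1⟩ ⟨hd, h2⟩
  refine (Set.ncard_le_ncard_of_injOn _ hmaps hinj (Finset.finite_toSet _)).trans ?_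
  rw [Set.ncard_coe_finset]
  refine (List.toFinset_card_le _).trans ?_
  rw [List.length_permutations, Finset.length_toList, hA]

theorem IsPerfectPermCode.factorial_le {t : ℕ} {C : Set (Equiv.Perm (Fin n))}
    (hC : IsPerfectPermCode t C) :
    (n - t).factorial ≤ C.ncard * n.choose (n - t) := by
  classical
  have hcover : (Set.univ : Set (Equiv.Perm (Fin n))) ⊆
      ⋃ c ∈ (Set.toFinite C).toFinset, psphere c t := by
    intro π _
    obtain ⟨c, ⟨hc, h⟩, -⟩ := hC π
    simp only [Set.mem_iUnion]
    exact ⟨c, by simpa using hc, h⟩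
  have hle : n.factorial ≤ ∑ c ∈ (Set.toFinite C).toFinset, (psphere c t).ncard := by
    have := (Set.ncard_le_ncard hcover (Set.toFinite _)).trans (Finset.set_ncard_biUnion_le _ _)
    rwa [Set.ncard_univ, Nat.card_perm, Nat.card_fin] at this
  refine Nat.le_of_mul_le_mul_left ?_ n.factorial_pos
  calc n.factorial * (n - t).factorial
      ≤ (∑ c ∈ (Set.toFinite C).toFinset, (psphere c t).ncard) * (n - t).factorial := by
        gcongr
    _ ≤ ∑ c ∈ (Set.toFinite C).toFinset, n.choose (n - t) * n.factorial := by
        rw [Finset.sum_mul]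
        exact Finset.sum_le_sum fun c _ => ncard_psphere_mul_le c t
    _ = n.factorial * (C.ncard * n.choose (n - t)) := by
        rw [Finset.sum_const, smul_eq_mul, ← Set.ncard_eq_toFinset_card C]
        ring

end Words

/-- If `n ≥ 2t` and `F(n,t) > 1`, then every perfect `t`-error correcting
permutation code in `S_n` is trivial. -/
theorem no_nontrivial_perfect_code_of_overlapping (n t : ℕ) (hn : 2 * t ≤ n)
    (hF : 1 < Ffun n t) (C : Set (Equiv.Perm (Fin n))) (hC : IsPerfectPermCode t C) :
    C = Set.univ ∨ C.ncard = 1 := by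
  exfalso
  refine absurd hF (not_lt.2 ?_)
  unfold Ffun
  rw [div_le_one (by positivity)]
  have h : (n - t).factorial ≤ (n - 2 * t).factorial * n.choose (n - t) :=
    hC.factorial_le.trans (Nat.mul_le_mul_right _ (hC.ncard_le hn))
  have hchoose := Nat.choose_mul_factorial_mul_factorial (n := n) (k := n - t) (by omega)
  rw [Nat.sub_sub_self (by omega : t ≤ n)] at hchoose
  have : (n - t).factorial ^ 2 * t.factorial ≤ n.factorial * (n - 2 * t).factorial :=
    calc (n - t).factorial ^ 2 * t.factorial
        = (n - t).factorial * ((n - t).factorial * t.factorial) := by ring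
      _ ≤ (n - 2 * t).factorial * n.choose (n - t) * ((n - t).factorial * t.factorial) :=
          Nat.mul_le_mul_right _ h
      _ = n.factorial * (n - 2 * t).factorial := by rw [← hchoose]; ring
  exact_mod_cast this
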